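/- Let ρ be a Borel probability measure on ℝ. Suppose (σ_t)_{t ≥ 0} and (μ_t)_{t ≥ 0} are families of Borel probability measures on ℝ such that for all t ≥ 0 and all z ∈ ℂ⁺: G_{σ_t}(z) = G_ρ(z − t·G_{σ_t}(z)) and G_{μ_t}(z) = 1/(z − t·G_{σ_t}(z)). Then for all 0 ≤ s ≤ t and all z ∈ ℂ⁺, the point w := z − (t−s)·G_{σ_t}(z) lies in ℂ⁺, and G_{σ_s}(w) = G_{σ_t}(z) and G_{μ_s}(w) = G_{μ_t}(z). (Thus the subordination functions F_{s,t}(z) = z − (t−s)G_{σ_t}(z) simultaneously subordinate both families, i.e. G_{μ_s}∘F_{s,t} = G_{μ_t} and G_{σ_s}∘F_{s,t} = G_{σ_t}.) -/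

import Mathlib

open MeasureTheory

/-- The Cauchy transform `G_m(z) = ∫ 1/(z - x) dm(x)` of a measure on `ℝ`. -/
noncomputable def cauchyTransform (m : Measure ℝ) (z : ℂ) : ℂ :=
  ∫ x, (z - (x : ℂ))⁻¹ ∂m

theorem norm_inv_sub_ofReal_le {z : ℂ} (hz : 0 < z.im) (x : ℝ) :
    ‖(z - (x : ℂ))⁻¹‖ ≤ z.im⁻¹ := by
  rw [norm_inv]
  refine inv_anti₀ hz ?_
  have h := Complex.abs_im_le_norm (z - (x : ℂ))
  simp only [Complex.sub_im, Complex.ofReal_im, sub_zero] at h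
  exact (le_abs_self _).trans h

theorem sub_ofReal_ne_zero {z : ℂ} (hz : 0 < z.im) (x : ℝ) : z - (x : ℂ) ≠ 0 := by
  intro h
  have := congrArg Complex.im h
  simp only [Complex.sub_im, Complex.ofReal_im, sub_zero, Complex.zero_im] at this
  exact hz.ne' this

theorem continuous_inv_sub_ofReal {z : ℂ} (hz : 0 < z.im) :
    Continuous fun x : ℝ => (z - (x : ℂ))⁻¹ :=
  (continuous_const.sub Complex.continuous_ofReal).inv₀ (sub_ofReal_ne_zero hz)

theorem integrable_inv_sub_ofReal (m : Measure ℝ) [IsFiniteMeasure m] {z : ℂ} (hz : 0 < z.im) :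
    Integrable (fun x : ℝ => (z - (x : ℂ))⁻¹) m :=
  Integrable.of_bound (continuous_inv_sub_ofReal hz).aestronglyMeasurable z.im⁻¹
    (.of_forall (norm_inv_sub_ofReal_le hz))

theorem integrable_norm_inv_sub_ofReal_sq (m : Measure ℝ) [IsFiniteMeasure m] {z : ℂ}
    (hz : 0 < z.im) : Integrable (fun x : ℝ => ‖(z - (x : ℂ))⁻¹‖ ^ 2) m := by
  refine Integrable.of_bound
    ((continuous_inv_sub_ofReal hz).norm.pow 2).aestronglyMeasurable (z.im⁻¹ ^ 2)
    (.of_forall fun x => ?_)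
  rw [Real.norm_of_nonneg (by positivity)]
  exact pow_le_pow_left₀ (norm_nonneg _) (norm_inv_sub_ofReal_le hz x) 2

theorem cauchyTransform_im (m : Measure ℝ) [IsFiniteMeasure m] {z : ℂ} (hz : 0 < z.im) :
    (cauchyTransform m z).im = -(z.im * ∫ x : ℝ, ‖(z - (x : ℂ))⁻¹‖ ^ 2 ∂m) := by
  have h : (cauchyTransform m z).im = ∫ x : ℝ, ((z - (x : ℂ))⁻¹).im ∂m :=
    (integral_im (𝕜 := ℂ) (integrable_inv_sub_ofReal m hz)).symm
  rw [h, ← integral_const_mul, ← integral_neg]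
  refine integral_congr_ae (.of_forall fun x => ?_)
  simp only [Complex.inv_im, Complex.sub_im, Complex.ofReal_im, sub_zero, norm_inv, inv_pow,
    ← Complex.normSq_eq_norm_sq]
  ring

theorem cauchyTransform_im_nonpos (m : Measure ℝ) [IsFiniteMeasure m] {z : ℂ} (hz : 0 < z.im) :
    (cauchyTransform m z).im ≤ 0 := by
  rw [cauchyTransform_im m hz, neg_nonpos]
  exact mul_nonneg hz.le (integral_nonneg fun x => by positivity)

theorem im_pos_sub_mul_cauchyTransform (m : Measure ℝ) [IsFiniteMeasure m] {z : ℂ}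
    (hz : 0 < z.im) {r : ℝ} (hr : 0 ≤ r) : 0 < (z - (r : ℂ) * cauchyTransform m z).im := by
  rw [Complex.sub_im, Complex.im_ofReal_mul]
  nlinarith [mul_nonneg hr (neg_nonneg.2 (cauchyTransform_im_nonpos m hz))]

theorem cauchyTransform_sub (m : Measure ℝ) [IsFiniteMeasure m] {u v : ℂ}
    (hu : 0 < u.im) (hv : 0 < v.im) :
    cauchyTransform m u - cauchyTransform m v =
      -((u - v) * ∫ x : ℝ, (u - (x : ℂ))⁻¹ * (v - (x : ℂ))⁻¹ ∂m) := by
  unfold cauchyTransform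
  rw [← integral_sub (integrable_inv_sub_ofReal m hu) (integrable_inv_sub_ofReal m hv),
    ← integral_const_mul, ← integral_neg]
  refine integral_congr_ae (.of_forall fun x => ?_)
  have h1 := sub_ofReal_ne_zero hu x
  have h2 := sub_ofReal_ne_zero hv x
  field_simp
  ring

theorem norm_integral_inv_mul_inv_le (m : Measure ℝ) [IsFiniteMeasure m] {u v : ℂ}
    (hu : 0 < u.im) (hv : 0 < v.im) :
    ‖∫ x : ℝ, (u - (x : ℂ))⁻¹ * (v - (x : ℂ))⁻¹ ∂m‖ ≤
      ((∫ x : ℝ, ‖(u - (x : ℂ))⁻¹‖ ^ 2 ∂m) + ∫ x : ℝ, ‖(v - (x : ℂ))⁻¹‖ ^ 2 ∂m) / 2 := by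
  have iu := integrable_norm_inv_sub_ofReal_sq m hu
  have iv := integrable_norm_inv_sub_ofReal_sq m hv
  rw [← integral_add iu iv, ← integral_div]
  refine norm_integral_le_of_norm_le ((iu.add iv).div_const 2) (.of_forall fun x => ?_)
  rw [norm_mul]
  linarith [two_mul_le_add_sq ‖(u - (x : ℂ))⁻¹‖ ‖(v - (x : ℂ))⁻¹‖]

theorem mul_integral_norm_inv_sq_lt_one (m : Measure ℝ) [IsFiniteMeasure m] {s : ℝ} {u w : ℂ}
    (hu : 0 < u.im) (hw : 0 < w.im) (h : u = w - (s : ℂ) * cauchyTransform m u) :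
    s * ∫ x : ℝ, ‖(u - (x : ℂ))⁻¹‖ ^ 2 ∂m < 1 := by
  have him := congrArg Complex.im h
  rw [Complex.sub_im, Complex.im_ofReal_mul, cauchyTransform_im m hu] at him
  refine lt_of_mul_lt_mul_left ?_ hu.le
  linarith

/-- The map `u ↦ w - s G_m(u)` has at most one fixed point in the upper half-plane. -/
theorem eq_of_eq_sub_mul_cauchyTransform (m : Measure ℝ) [IsFiniteMeasure m] {s : ℝ}
    (hs : 0 ≤ s) {u v w : ℂ} (hu : 0 < u.im) (hv : 0 < v.im) (hw : 0 < w.im)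
    (hfu : u = w - (s : ℂ) * cauchyTransform m u)
    (hfv : v = w - (s : ℂ) * cauchyTransform m v) : u = v := by
  by_contra hne
  have hI : (s : ℂ) * ∫ x : ℝ, (u - (x : ℂ))⁻¹ * (v - (x : ℂ))⁻¹ ∂m = 1 :=
    mul_left_cancel₀ (sub_ne_zero.2 hne) (by
      linear_combination hfv - hfu + (s : ℂ) * cauchyTransform_sub m hu hv)
  have hn := congrArg norm hI
  rw [norm_mul, Complex.norm_of_nonneg hs, norm_one] at hn
  have := mul_le_mul_of_nonneg_left (norm_integral_inv_mul_inv_le m hu hv) hs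
  linarith [mul_integral_norm_inv_sq_lt_one m hu hw hfu,
    mul_integral_norm_inv_sq_lt_one m hv hw hfv]


/-- A centered free Lévy process of the first kind with canonical measure `ρ` has the same
transition functions as the free Brownian motion started at `ρ`: if
`G_{σ_t}(z) = G_ρ(z - t G_{σ_t}(z))` (so `σ_t = ρ ⊞ γ_t`) and
`G_{μ_t}(z) = 1/(z - t G_{σ_t}(z))`, then for `0 ≤ s ≤ t` the subordination point
`w = z - (t - s) G_{σ_t}(z)` lies in `ℂ⁺` and `G_{σ_s}(w) = G_{σ_t}(z)`,
`G_{μ_s}(w) = G_{μ_t}(z)`. -/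
theorem stmt_7 (ρ : Measure ℝ) [IsProbabilityMeasure ρ]
    (σ μ : ℝ → Measure ℝ)
    (hσprob : ∀ t : ℝ, 0 ≤ t → IsProbabilityMeasure (σ t))
    (hμprob : ∀ t : ℝ, 0 ≤ t → IsProbabilityMeasure (μ t))
    (hσ : ∀ t : ℝ, 0 ≤ t → ∀ z : ℂ, 0 < z.im →
      cauchyTransform (σ t) z = cauchyTransform ρ (z - (t : ℂ) * cauchyTransform (σ t) z))
    (hμ : ∀ t : ℝ, 0 ≤ t → ∀ z : ℂ, 0 < z.im →
      cauchyTransform (μ t) z = (z - (t : ℂ) * cauchyTransform (σ t) z)⁻¹) :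
    ∀ s t : ℝ, 0 ≤ s → s ≤ t → ∀ z : ℂ, 0 < z.im →
      0 < (z - ((t - s : ℝ) : ℂ) * cauchyTransform (σ t) z).im ∧
      cauchyTransform (σ s) (z - ((t - s : ℝ) : ℂ) * cauchyTransform (σ t) z)
        = cauchyTransform (σ t) z ∧
      cauchyTransform (μ s) (z - ((t - s : ℝ) : ℂ) * cauchyTransform (σ t) z)
        = cauchyTransform (μ t) z := by
  intro s t hs hst z hz
  have ht := hs.trans hst
  have := hσprob t ht
  have := hσprob s hs
  have hw := im_pos_sub_mul_cauchyTransform (σ t) hz (sub_nonneg.2 hst)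
  have hu := im_pos_sub_mul_cauchyTransform (σ t) hz ht
  have hgt := hσ t ht z hz
  have hμt := hμ t ht z hz
  set g := cauchyTransform (σ t) z
  set w := z - ((t - s : ℝ) : ℂ) * g with hw_def
  have hv := im_pos_sub_mul_cauchyTransform (σ s) hw hs
  have hgs := hσ s hs w hw
  have hμs := hμ s hs w hw
  have hzw : z - (t : ℂ) * g = w - (s : ℂ) * g := by
    rw [hw_def]; push_cast; ring
  have huv : z - (t : ℂ) * g = w - (s : ℂ) * cauchyTransform (σ s) w :=
    eq_of_eq_sub_mul_cauchyTransform ρ hs hu hv hw (by rw [← hgt, hzw]) (by rw [← hgs])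
  refine ⟨hw, ?_, ?_⟩
  · rw [hgs, ← huv, ← hgt]
  · rw [hμs, ← huv, ← hμt]
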